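/- Let s ∈ (0,1) and n ≥ 2. There exists C_1 > 0 depending only on s and n such that for every origin-centered ellipsoid E ⊂ ℝ^n with largest half-axis a_n attained in direction e_n, and every ξ ∈ (0, 1/2), writing Γ_ξ = {x ∈ S^{n-1} : |⟨x, e_n⟩| ≤ ξ}, one has ∫_{Γ_ξ} h_E(v)^{-s} dH^{n-1}(v) ≤ C_1 · ξ^{(1-s)/(2-s)} · a_n^{-s}. -/

import Mathlib

open MeasureTheory
open scoped RealInnerProductSpace

/-- The support function of a set `K`: `h_K(v) = sup_{x ∈ K} ⟨x, v⟩`. -/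
noncomputable def suppFn {n : ℕ} (K : Set (EuclideanSpace ℝ (Fin n)))
    (v : EuclideanSpace ℝ (Fin n)) : ℝ :=
  sSup ((fun x => ⟪x, v⟫) '' K)


lemma piece {n : ℕ} (hn : 2 ≤ n) (b : OrthonormalBasis (Fin n) ℝ (EuclideanSpace ℝ (Fin n)))
    (i0 i : Fin n) (hi : i ≠ i0) (σ : ℝ) (hσ : |σ| = 1) (t : ℝ) (ht : 0 ≤ t) :
    μH[(n:ℝ)-1] {v : EuclideanSpace ℝ (Fin n) | ‖v‖ = 1 ∧ |⟪b i0, v⟫| ≤ t ∧ 1/(n:ℝ) ≤ σ * ⟪b i, v⟫}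
      ≤ ENNReal.ofReal (((n:ℝ)^3)^((n:ℝ)-1) * 2^n * t) := by
  classical
  have hn0 : (2:ℝ) ≤ n := by exact_mod_cast hn
  set A := {v : EuclideanSpace ℝ (Fin n) | ‖v‖ = 1 ∧ |⟪b i0, v⟫| ≤ t ∧ 1/(n:ℝ) ≤ σ * ⟪b i, v⟫} with hA
  let f : A → ({j : Fin n // j ≠ i} → ℝ) := fun v j => ⟪b j, (v : EuclideanSpace ℝ (Fin n))⟫
  have hsq : ∀ v : EuclideanSpace ℝ (Fin n), ∑ j, ⟪b j, v⟫^2 = ‖v‖^2 := fun v => by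
    have := b.sum_sq_norm_inner_right v
    simpa using this
  have hcoord : ∀ v : EuclideanSpace ℝ (Fin n), ∀ j, |⟪b j, v⟫| ≤ ‖v‖ := fun v j => by
    have := abs_real_inner_le_norm (b j) v
    simpa using this
  have hf : AntilipschitzWith ((n:NNReal)^3) f := by
    apply AntilipschitzWith.of_le_mul_dist
    rintro ⟨v, hv1, hv2, hv3⟩ ⟨w, hw1, hw2, hw3⟩
    set D := dist (f ⟨v, hv1, hv2, hv3⟩) (f ⟨w, hw1, hw2, hw3⟩) with hD
    have hD0 : 0 ≤ D := dist_nonneg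
    have hj : ∀ j, j ≠ i → |⟪b j, v⟫ - ⟪b j, w⟫| ≤ D := fun j hj => by
      have := dist_le_pi_dist (f ⟨v, hv1, hv2, hv3⟩) (f ⟨w, hw1, hw2, hw3⟩) ⟨j, hj⟩
      simpa [Real.dist_eq, f] using this
    have h0 : (⟪b i, v⟫ - ⟪b i, w⟫) * (⟪b i, v⟫ + ⟪b i, w⟫) =
        - ∑ j ∈ Finset.univ.erase i, (⟪b j, v⟫ - ⟪b j, w⟫) * (⟪b j, v⟫ + ⟪b j, w⟫) := by
      have h1 : ∑ j, (⟪b j, v⟫ - ⟪b j, w⟫) * (⟪b j, v⟫ + ⟪b j, w⟫) = 0 := by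
        have : ∀ j, (⟪b j, v⟫ - ⟪b j, w⟫) * (⟪b j, v⟫ + ⟪b j, w⟫) = ⟪b j, v⟫^2 - ⟪b j, w⟫^2 :=
          fun j => by ring
        simp_rw [this, Finset.sum_sub_distrib, hsq, hv1, hw1]; simp
      rw [← Finset.add_sum_erase _ _ (Finset.mem_univ i)] at h1
      linarith
    have h2 : |(⟪b i, v⟫ - ⟪b i, w⟫) * (⟪b i, v⟫ + ⟪b i, w⟫)| ≤ n * (D * 2) := by
      rw [h0, abs_neg]
      refine (Finset.abs_sum_le_sum_abs _ _).trans ?_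
      have : ∀ j ∈ Finset.univ.erase i, |(⟪b j, v⟫ - ⟪b j, w⟫) * (⟪b j, v⟫ + ⟪b j, w⟫)| ≤ D * 2 := by
        intro j hj'
        rw [abs_mul]
        have a1 := hcoord v j
        have a2 := hcoord w j
        rw [hv1] at a1
        rw [hw1] at a2
        have a3 := abs_add_le ⟪b j, v⟫ ⟪b j, w⟫
        exact mul_le_mul (hj j (Finset.ne_of_mem_erase hj')) (by linarith) (abs_nonneg _) hD0
      refine (Finset.sum_le_card_nsmul _ _ _ this).trans ?_
      rw [nsmul_eq_mul]
      have : ((Finset.univ.erase i).card : ℝ) ≤ n := by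
        exact_mod_cast (Finset.card_le_univ _).trans (by simp)
      gcongr
    have h3 : 2 / (n:ℝ) ≤ |⟪b i, v⟫ + ⟪b i, w⟫| := by
      have : |σ * (⟪b i, v⟫ + ⟪b i, w⟫)| = |⟪b i, v⟫ + ⟪b i, w⟫| := by rw [abs_mul, hσ, one_mul]
      rw [← this]
      refine le_trans ?_ (le_abs_self _)
      rw [mul_add]
      have : 2 / (n:ℝ) = 1/(n:ℝ) + 1/(n:ℝ) := by ring
      linarith
    have h4 : |⟪b i, v⟫ - ⟪b i, w⟫| ≤ n^2 * D := by
      rw [abs_mul] at h2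
      have := (mul_le_mul_of_nonneg_left h3 (abs_nonneg (⟪b i, v⟫ - ⟪b i, w⟫))).trans h2
      rw [mul_div_assoc', div_le_iff₀ (by linarith)] at this
      linarith
    have h5 : ∀ j, |⟪b j, v⟫ - ⟪b j, w⟫| ≤ n^2 * D := fun j => by
      by_cases h : j = i
      · rw [h]; exact h4
      · exact (hj j h).trans (le_mul_of_one_le_left hD0 (by nlinarith))
    have h6 : ‖v - w‖^2 ≤ (n^3*D)^2 := by
      rw [← hsq]
      have : ∀ j ∈ Finset.univ, ⟪b j, v - w⟫^2 ≤ (n^2*D)^2 := fun j _ => by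
        rw [inner_sub_right, ← sq_abs]
        gcongr
        exact h5 j
      refine (Finset.sum_le_card_nsmul _ _ _ this).trans ?_
      simp only [Finset.card_univ, Fintype.card_fin, nsmul_eq_mul]
      have : 0 ≤ (n:ℝ)*(n^2*D)^2 := by positivity
      have : (n^3*D)^2 = (n:ℝ) * (n*(n^2*D)^2) := by ring
      nlinarith
    have := abs_le_of_sq_le_sq h6 (by positivity)
    simpa [Subtype.dist_eq, dist_eq_norm] using this
  have hi0 : i0 ≠ i := hi.symm
  let r : {j : Fin n // j ≠ i} → ℝ := fun j => if j = ⟨i0, hi0⟩ then t else 1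
  have hsub : (Subtype.val '' (f ⁻¹' Set.Icc (-r) r)) = A := by
    ext v
    constructor
    · rintro ⟨v, -, rfl⟩
      exact v.2
    · intro hv
      refine ⟨⟨v, hv⟩, ?_, rfl⟩
      have : ∀ j, |f ⟨v, hv⟩ j| ≤ r j := by
        intro j
        by_cases h : j = ⟨i0, hi0⟩
        · simp only [r, f, h, if_true]; exact hv.2.1
        · simp only [r, f, h, if_false]
          have := hcoord v j
          rwa [hv.1] at this
      exact ⟨fun j => (abs_le.1 (this j)).1, fun j => (abs_le.1 (this j)).2⟩
  have hn1 : (0:ℝ) ≤ (n:ℝ) - 1 := by linarith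
  have hcard : (Fintype.card {j : Fin n // j ≠ i} : ℝ) = (n:ℝ) - 1 := by
    simp [Fintype.card_subtype_compl]
    rw [Nat.cast_sub (by omega)]; simp
  rw [← hsub, isometry_subtype_coe.hausdorffMeasure_image (Or.inl hn1)]
  refine (hf.hausdorffMeasure_preimage_le hn1 _).trans ?_
  rw [← hcard, hausdorffMeasure_pi_real, Real.volume_Icc_pi, hcard,
    ← ENNReal.ofReal_prod_of_nonneg]
  · have : ∏ j, (r j - (-r) j) ≤ 2^n * t := by
      have e1 : ∀ j, r j - (-r) j = 2 * r j := fun j => by simp; ring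
      simp_rw [e1, Finset.prod_mul_distrib]
      have : ∏ j, r j = t := by simp [r, Finset.prod_ite_eq']
      rw [this]
      gcongr
      simp only [Finset.prod_const]
      apply pow_le_pow_right₀ (by norm_num)
      exact (Fintype.card_subtype_le _).trans (by simp)
    have e2 : (((n:NNReal)^3 : NNReal) : ENNReal) ^ ((n:ℝ)-1) = ENNReal.ofReal (((n:ℝ)^3)^((n:ℝ)-1)) := by
      rw [← ENNReal.ofReal_rpow_of_nonneg (by positivity) hn1]
      congr 1
      rw [ENNReal.ofReal_pow (by positivity)]
      simp
    rw [e2, mul_assoc, ENNReal.ofReal_mul (by positivity)]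
    gcongr
  · intro j _
    have : 0 ≤ r j := by simp only [r]; split_ifs <;> linarith
    simp; linarith

lemma band {n : ℕ} (hn : 2 ≤ n) : ∃ M : ℝ, 0 < M ∧ ∀ e : EuclideanSpace ℝ (Fin n), ‖e‖ = 1 →
    ∀ t : ℝ, 0 ≤ t → t ≤ 1/2 →
    μH[(n:ℝ)-1] {v : EuclideanSpace ℝ (Fin n) | v ∈ Metric.sphere 0 1 ∧ |⟪v, e⟫| ≤ t} ≤
      ENNReal.ofReal (M * t) := by
  classical
  have hn0 : (2:ℝ) ≤ n := by exact_mod_cast hn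
  refine ⟨n * (2 * (((n:ℝ)^3)^((n:ℝ)-1) * 2^n)), by positivity, fun e he t ht0 ht => ?_⟩
  let i0 : Fin n := ⟨0, by omega⟩
  obtain ⟨b, hb⟩ := Orthonormal.exists_orthonormalBasis_extension_of_card_eq (𝕜 := ℝ)
    (E := EuclideanSpace ℝ (Fin n)) (ι := Fin n) (by simp) (v := fun _ => e) (s := {i0}) (by
      constructor
      · intro i; simpa using he
      · intro i j h; exact absurd (Subsingleton.elim i j) h)
  have hb0 : b i0 = e := hb i0 rfl
  let S : Fin n → ℝ → Set (EuclideanSpace ℝ (Fin n)) := fun i σ =>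
    {v | ‖v‖ = 1 ∧ |⟪b i0, v⟫| ≤ t ∧ 1/(n:ℝ) ≤ σ * ⟪b i, v⟫}
  have hcov : {v : EuclideanSpace ℝ (Fin n) | v ∈ Metric.sphere 0 1 ∧ |⟪v, e⟫| ≤ t} ⊆
      ⋃ i ∈ Finset.univ.erase i0, (S i 1 ∪ S i (-1)) := by
    rintro v ⟨hv, hve⟩
    have hv1 : ‖v‖ = 1 := by simpa using hv
    rw [real_inner_comm, ← hb0] at hve
    by_contra hcon
    simp only [Set.mem_iUnion, not_exists] at hcon
    have hsm : ∀ i ∈ Finset.univ.erase i0, ⟪b i, v⟫^2 ≤ (1/(n:ℝ))^2 := by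
      intro i hi
      have h := hcon i hi
      simp only [Set.mem_union, not_or, S, Set.mem_ofPred_eq, not_and, not_le] at h
      have h1 := h.1 hv1 hve
      have h2 := h.2 hv1 hve
      exact sq_le_sq' (by linarith) (by linarith)
    have hsum : ∑ j, ⟪b j, v⟫^2 = 1 := by
      have := b.sum_sq_norm_inner_right v
      simpa [hv1] using this
    rw [← Finset.add_sum_erase _ _ (Finset.mem_univ i0)] at hsum
    have h3 := Finset.sum_le_card_nsmul _ _ _ hsm
    have h4 : ((Finset.univ.erase i0).card : ℝ) ≤ n := by
      exact_mod_cast (Finset.card_le_univ _).trans (by simp)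
    rw [nsmul_eq_mul] at h3
    have h5 : ((Finset.univ.erase i0).card : ℝ) * (1/(n:ℝ))^2 ≤ n * (1/(n:ℝ))^2 := by gcongr
    have h6 : n * (1/(n:ℝ))^2 = 1/n := by field_simp
    have h7 : 1/(n:ℝ) ≤ 1/2 := by gcongr
    have h8 : ⟪b i0, v⟫^2 ≤ (1/2)^2 := sq_le_sq' (by linarith [(abs_le.1 hve).1]) (by linarith [(abs_le.1 hve).2])
    linarith
  refine (measure_mono hcov).trans ((measure_biUnion_finset_le _ _).trans ?_)
  have hp : ∀ i ∈ Finset.univ.erase i0, μH[(n:ℝ)-1] (S i 1 ∪ S i (-1)) ≤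
      ENNReal.ofReal (2 * (((n:ℝ)^3)^((n:ℝ)-1) * 2^n * t)) := by
    intro i hi
    have hi := Finset.ne_of_mem_erase hi
    refine (measure_union_le _ _).trans ((add_le_add (piece hn b i0 i hi 1 (by simp) t ht0)
      (piece hn b i0 i hi (-1) (by simp) t ht0)).trans ?_)
    rw [← ENNReal.ofReal_add (by positivity) (by positivity), two_mul]
  refine (Finset.sum_le_card_nsmul _ _ _ hp).trans ?_
  rw [nsmul_eq_mul, ← ENNReal.ofReal_natCast, ← ENNReal.ofReal_mul (by positivity)]
  apply ENNReal.ofReal_le_ofReal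
  have h4 : ((Finset.univ.erase i0).card : ℝ) ≤ n := by
      exact_mod_cast (Finset.card_le_univ _).trans (by simp)
  calc _ ≤ (n:ℝ) * (2 * (((n:ℝ)^3)^((n:ℝ)-1) * 2^n * t)) := by gcongr
    _ = _ := by ring

lemma suppFn_ge {n : ℕ} (Φ : EuclideanSpace ℝ (Fin n) ≃L[ℝ] EuclideanSpace ℝ (Fin n))
    (e : EuclideanSpace ℝ (Fin n)) (aN : ℝ) (he : ‖e‖ = 1)
    (hg : IsGreatest ((fun x => ‖x‖) '' (⇑Φ '' Metric.closedBall 0 1)) aN)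
    (hfr : aN • e ∈ frontier (⇑Φ '' Metric.closedBall 0 1)) :
    0 < aN ∧ ∀ v : EuclideanSpace ℝ (Fin n),
      aN * |⟪v, e⟫| ≤ suppFn (⇑Φ '' Metric.closedBall 0 1) v := by
  have hpos : 0 < aN := by
    have h1 : ‖Φ e‖ ≤ aN := hg.2 ⟨Φ e, ⟨e, by simp [he], rfl⟩, rfl⟩
    have h2 : Φ e ≠ 0 := by
      intro h
      have : e = 0 := by simpa using h
      simp [this] at he
    exact (norm_pos_iff.2 h2).trans_le h1
  refine ⟨hpos, fun v => ?_⟩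
  have hcl : IsClosed (⇑Φ '' Metric.closedBall 0 1) :=
    ((isCompact_closedBall _ _).image Φ.continuous).isClosed
  have hmem : aN • e ∈ ⇑Φ '' Metric.closedBall 0 1 := hcl.frontier_subset hfr
  have hneg : -(aN • e) ∈ ⇑Φ '' Metric.closedBall 0 1 := by
    obtain ⟨x, hx, hxe⟩ := hmem
    exact ⟨-x, by simpa using hx, by rw [map_neg, hxe]⟩
  have hbdd : BddAbove ((fun x => ⟪x, v⟫) '' (⇑Φ '' Metric.closedBall 0 1)) := by
    refine ⟨aN * ‖v‖, ?_⟩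
    rintro _ ⟨x, hx, rfl⟩
    refine (real_inner_le_norm x v).trans ?_
    have : ‖x‖ ≤ aN := hg.2 ⟨x, hx, rfl⟩
    gcongr
  have h1 : ⟪aN • e, v⟫ ≤ suppFn (⇑Φ '' Metric.closedBall 0 1) v :=
    le_csSup hbdd ⟨_, hmem, rfl⟩
  have h2 : ⟪-(aN • e), v⟫ ≤ suppFn (⇑Φ '' Metric.closedBall 0 1) v :=
    le_csSup hbdd ⟨_, hneg, rfl⟩
  rw [inner_neg_left] at h2
  rw [real_inner_smul_left, real_inner_comm] at h1 h2
  rcases abs_cases ⟪v, e⟫ with h | h <;> rw [h.1] <;> linarith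

/-- For `s ∈ (0,1)` and `n ≥ 2`, there is `C₁ > 0` depending only on `s` and `n` such that
for every origin-centered ellipsoid `E ⊂ ℝ^n` with largest half-axis `aN` attained in the
unit direction `e`, and every `ξ ∈ (0,1/2)`, writing `Γ_ξ = {x ∈ S^{n-1} : |⟨x,e⟩| ≤ ξ}`,
one has `∫_{Γ_ξ} h_E(v)^(-s) dH^{n-1}(v) ≤ C₁ ξ^((1-s)/(2-s)) aN^(-s)`. -/
theorem stmt_9 (n : ℕ) (hn : 2 ≤ n) (s : ℝ) (hs : s ∈ Set.Ioo (0 : ℝ) 1) :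
    ∃ C₁ : ℝ, 0 < C₁ ∧
      ∀ Φ : EuclideanSpace ℝ (Fin n) ≃L[ℝ] EuclideanSpace ℝ (Fin n),
      ∀ e : EuclideanSpace ℝ (Fin n), ∀ aN : ℝ, ∀ ξ : ℝ, ‖e‖ = 1 →
        IsGreatest ((fun x => ‖x‖) '' (⇑Φ '' Metric.closedBall 0 1)) aN →
        aN • e ∈ frontier (⇑Φ '' Metric.closedBall 0 1) →
        ξ ∈ Set.Ioo (0 : ℝ) (1/2) →
        (∫ v in {x : EuclideanSpace ℝ (Fin n) | x ∈ Metric.sphere 0 1 ∧ |⟪x, e⟫| ≤ ξ},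
            (suppFn (⇑Φ '' Metric.closedBall 0 1) v) ^ (-s) ∂(μH[(n : ℝ) - 1]))
          ≤ C₁ * ξ ^ ((1 - s)/(2 - s)) * aN ^ (-s) := by
  obtain ⟨hs0, hs1⟩ := hs
  obtain ⟨M, hM, hband⟩ := band hn
  have hq0 : (0:ℝ) < (1/2)^(1-s) := by positivity
  have hq1 : ((1:ℝ)/2)^(1-s) < 1 := Real.rpow_lt_one (by norm_num) (by norm_num) (by linarith)
  set q : ℝ := (1/2)^(1-s) with hq
  have hq2 : 0 < (1 - q)⁻¹ := inv_pos.2 (by linarith)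
  refine ⟨M * (1/2)^(-s) * (1 - q)⁻¹, by positivity, ?_⟩
  intro Φ e aN ξ he hg hfr ⟨hξ0, hξ1⟩
  obtain ⟨ha, hsupp⟩ := suppFn_ge Φ e aN he hg hfr
  set h := suppFn (⇑Φ '' Metric.closedBall 0 1) with hh
  set S := {x : EuclideanSpace ℝ (Fin n) | x ∈ Metric.sphere 0 1 ∧ |⟪x, e⟫| ≤ ξ} with hS
  let Z := {x : EuclideanSpace ℝ (Fin n) | x ∈ Metric.sphere 0 1 ∧ |⟪x, e⟫| ≤ 0}
  let B : ℕ → Set (EuclideanSpace ℝ (Fin n)) := fun k =>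
    {x | (x ∈ Metric.sphere 0 1 ∧ |⟪x, e⟫| ≤ ξ * (1/2)^k) ∧ ξ * (1/2)^(k+1) < |⟪x, e⟫|}
  have hcov : S ⊆ Z ∪ ⋃ k, B k := by
    rintro x ⟨hx, hxξ⟩
    by_cases h0 : |⟪x, e⟫| ≤ 0
    · exact Or.inl ⟨hx, h0⟩
    · right
      have h0 := not_le.1 h0
      obtain ⟨k, hk1, hk2⟩ := exists_nat_pow_near_of_lt_one (x := |⟪x, e⟫| / ξ) (y := (1/2:ℝ))
        (by positivity) ((div_le_one hξ0).2 hxξ) (by norm_num) (by norm_num)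
      rw [lt_div_iff₀ hξ0] at hk1
      rw [div_le_iff₀ hξ0] at hk2
      exact Set.mem_iUnion.2 ⟨k, ⟨hx, by linarith⟩, by linarith⟩
  have hZ : μH[(n:ℝ)-1] Z = 0 := by
    have := hband e he 0 le_rfl (by norm_num)
    rw [mul_zero, ENNReal.ofReal_zero] at this
    exact le_antisymm this bot_le
  set c : ℝ := aN^(-s) * ξ^(1-s) * (M * (1/2)^(-s)) with hc
  have hc0 : 0 < c := by positivity
  have hB : ∀ k, ∫⁻ v in B k, ‖h v ^ (-s)‖ₑ ∂(μH[(n:ℝ)-1]) ≤ ENNReal.ofReal (c * q^k) := by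
    intro k
    have hr : 0 < aN * (ξ * (1/2)^(k+1)) := by positivity
    have hle : ∀ v ∈ B k, ‖h v ^ (-s)‖ₑ ≤ ENNReal.ofReal ((aN * (ξ * (1/2)^(k+1)))^(-s)) := by
      intro v hv
      have h1 : aN * (ξ * (1/2)^(k+1)) ≤ h v :=
        (mul_le_mul_of_nonneg_left hv.2.le ha.le).trans (hsupp v)
      have h2 : 0 < h v := hr.trans_le h1
      rw [Real.enorm_of_nonneg (by positivity)]
      exact ENNReal.ofReal_le_ofReal (Real.rpow_le_rpow_of_nonpos hr h1 (by linarith))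
    refine (setLIntegral_mono measurable_const hle).trans ?_
    rw [setLIntegral_const]
    have hp1 : ((1:ℝ)/2)^k ≤ 1 := pow_le_one₀ (by norm_num) (by norm_num)
    have hm : μH[(n:ℝ)-1] (B k) ≤ ENNReal.ofReal (M * (ξ * (1/2)^k)) :=
      (measure_mono (fun x hx => hx.1)).trans
        (hband e he (ξ * (1/2)^k) (by positivity) (by nlinarith))
    refine (mul_le_mul' le_rfl hm).trans ?_
    rw [← ENNReal.ofReal_mul (by positivity)]
    apply ENNReal.ofReal_le_ofReal
    apply le_of_eq
    have e1 : (aN * (ξ * (1/2)^(k+1)))^(-s) = aN^(-s) * (ξ^(-s) * (((1/2:ℝ)^(-s))^k * (1/2)^(-s))) := by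
      rw [Real.mul_rpow (by positivity) (by positivity), Real.mul_rpow (by positivity) (by positivity),
        ← Real.rpow_natCast_mul (by positivity), mul_comm _ (-s), Real.rpow_mul_natCast (by positivity),
        pow_succ]
    have e2 : ξ^(1-s) = ξ * ξ^(-s) := by
      rw [sub_eq_add_neg, Real.rpow_add hξ0, Real.rpow_one]
    have e3 : q = (1/2) * (1/2)^(-s) := by
      rw [hq, sub_eq_add_neg, Real.rpow_add (by norm_num), Real.rpow_one]
    rw [e1, hc, e2, e3, mul_pow]
    ring
  have hgeo : HasSum (fun k => c * q^k) (c * (1-q)⁻¹) :=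
    (hasSum_geometric_of_lt_one hq0.le hq1).mul_left c
  have hl : ∫⁻ v in S, ‖h v ^ (-s)‖ₑ ∂(μH[(n:ℝ)-1]) ≤ ENNReal.ofReal (c * (1-q)⁻¹) := by
    refine (lintegral_mono_set hcov).trans ((lintegral_union_le _ _ _).trans ?_)
    rw [setLIntegral_measure_zero _ _ hZ, zero_add]
    refine (lintegral_iUnion_le _ _).trans ?_
    rw [← hgeo.tsum_eq, ENNReal.ofReal_tsum_of_nonneg (fun k => by positivity) hgeo.summable]
    exact ENNReal.tsum_le_tsum hB
  have hfin : ∫ v in S, h v ^ (-s) ∂(μH[(n:ℝ)-1]) ≤ c * (1-q)⁻¹ := by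
    have h1 := (enorm_integral_le_lintegral_enorm (fun v => h v ^ (-s))).trans hl
    rw [Real.enorm_eq_ofReal_abs] at h1
    exact (le_abs_self _).trans ((ENNReal.ofReal_le_ofReal_iff (by positivity)).1 h1)
  refine hfin.trans ?_
  have hexp : ξ^(1-s) ≤ ξ^((1-s)/(2-s)) := by
    apply Real.rpow_le_rpow_of_exponent_ge hξ0 (by linarith)
    exact div_le_self (by linarith) (by linarith)
  calc c * (1-q)⁻¹ = M * (1/2)^(-s) * (1 - q)⁻¹ * ξ^(1-s) * aN^(-s) := by rw [hc]; ring
    _ ≤ _ := by gcongr
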